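/- Let k ≥ 3 be an integer and let x ∈ S_{2^k} be a 2-element. Then Sub_{S_{2^k}}(x) is a proper subgroup of S_{2^k} if and only if one of the following holds: (i) x is a 2^k-cycle; (ii) the order of x is 2^{k−1} and x has at least one fixed point on {1, …, 2^k}. -/

import Mathlib

open CategoryTheory

noncomputable section

/-- The set of irreducible complex characters of a group `G`. -/
def Irr (G : Type) [Group G] : Set (G → ℂ) :=
  {χ | ∃ V : FDRep ℂ G, Simple V ∧ V.character = χ}

/-- The irreducible characters of `G` that do not vanish at `g`. -/
def IrrX (G : Type) [Group G] (g : G) : Set (G → ℂ) :=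
  {χ | χ ∈ Irr G ∧ χ g ≠ 0}

/-- The irreducible characters of `G` of degree not divisible by `p`. -/
def IrrP' (p : ℕ) (G : Type) [Group G] : Set (G → ℂ) :=
  {χ | ∃ V : FDRep ℂ G, Simple V ∧ V.character = χ ∧ ¬ (p ∣ Module.finrank ℂ V)}

/-- The degree of a character, recovered from its value at `1`. -/
def charDeg {G : Type} [Group G] (χ : G → ℂ) : ℕ := ⌊(χ 1).re⌋₊

/-- The `p`-part of a natural number. -/
def pPart (p m : ℕ) : ℕ := p ^ (m.factorization p)

/-- `x` is a picky `p`-element: a `p`-element lying in a unique Sylow `p`-subgroup. -/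
def IsPicky (p : ℕ) {G : Type*} [Group G] (x : G) : Prop :=
  (∃ k, orderOf x = p ^ k) ∧ ∃! Q : Sylow p G, x ∈ Q

/-- `H` is a normal subgroup of `K` (both subgroups of an ambient group `G`). -/
def NormalIn {G : Type*} [Group G] (H K : Subgroup G) : Prop :=
  H ≤ K ∧ ∀ k ∈ K, ∀ h ∈ H, k * h * k⁻¹ ∈ H

/-- `H` is subnormal in `K`: there is a finite chain of subgroups from `H` to `K`,
each normal in the next. -/
def IsSubnormalIn {G : Type*} [Group G] (H K : Subgroup G) : Prop :=
  Relation.ReflTransGen NormalIn H K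

/-- The subnormalizer of `x` in `G`: the subgroup generated by all `g` such that
`⟨x⟩` is subnormal in `⟨x, g⟩`. -/
def subnormalizer {G : Type*} [Group G] (x : G) : Subgroup G :=
  Subgroup.closure {g | IsSubnormalIn (Subgroup.zpowers x) (Subgroup.closure {x, g})}

lemma mem_subnormalizer_self {G : Type*} [Group G] (x : G) : x ∈ subnormalizer x :=
  Subgroup.subset_closure (by
    show IsSubnormalIn (Subgroup.zpowers x) (Subgroup.closure {x, x})
    rw [Set.pair_eq_singleton, ← Subgroup.zpowers_eq_closure]
    exact Relation.ReflTransGen.refl)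

/-- The full cycle type of a permutation of `Fin n`: the multiset of the lengths of
all its cycles, with fixed points counted as cycles of length `1`. -/
def fullCycleType {n : ℕ} (x : Equiv.Perm (Fin n)) : Multiset ℕ :=
  x.cycleType + Multiset.replicate (n - x.support.card) 1

/-- The multiset of cycle lengths of a `p`-adic element of `S_n`: `a_i` cycles of
length `p ^ i`, where `n = Σ a_i p ^ i` is the `p`-adic expansion of `n`. -/
def padicCycleMultiset (p n : ℕ) : Multiset ℕ :=
  ∑ i ∈ Finset.range (Nat.digits p n).length,
    Multiset.replicate ((Nat.digits p n).getD i 0) (p ^ i)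

/-- A `p`-adic element of `S_n`. -/
def IsPAdic (p : ℕ) {n : ℕ} (x : Equiv.Perm (Fin n)) : Prop :=
  fullCycleType x = padicCycleMultiset p n

/-- A picky element of Type II: a `2`-adic element on `n - 2` points together with
two fixed points. -/
def IsTypeII {n : ℕ} (x : Equiv.Perm (Fin n)) : Prop :=
  fullCycleType x = padicCycleMultiset 2 (n - 2) + Multiset.replicate 2 1

/-- A picky element of Type III: a `3`-adic element on `n - 3` points together with
three fixed points. -/
def IsTypeIII {n : ℕ} (x : Equiv.Perm (Fin n)) : Prop :=
  fullCycleType x = padicCycleMultiset 3 (n - 3) + Multiset.replicate 3 1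

section Group

variable {G : Type*} [Group G] {p : ℕ} {x : G}

/-- Every subgroup of a finite `p`-group is subnormal in it. -/
theorem IsPGroup.isSubnormalIn [Finite G] [Fact p.Prime] {H K : Subgroup G}
    (hK : IsPGroup p K) (hHK : H ≤ K) : IsSubnormalIn H K := by
  induction H using WellFoundedGT.induction with
  | ind H ih =>
    rcases hHK.eq_or_lt with rfl | hlt
    · exact Relation.ReflTransGen.refl
    have := hK.isNilpotent
    have hlt' : H.subgroupOf K < ⊤ := by
      refine lt_top_iff_ne_top.mpr fun h => hlt.not_ge ?_
      exact Subgroup.subgroupOf_eq_top.mp h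
    obtain ⟨g, hgN, hgH⟩ := SetLike.exists_of_lt
      (Group.normalizerCondition_of_isNilpotent (G := K) _ hlt')
    rw [Subgroup.mem_normalizer_iff] at hgN
    have hg : (g : G) ∈ Subgroup.normalizer (H : Set G) := by
      refine Subgroup.mem_normalizer_iff.mpr fun h => ⟨fun hh => ?_, fun hh => ?_⟩
      · exact (hgN ⟨h, hHK hh⟩).1 hh
      · have hhK : h ∈ K := by
          have := K.mul_mem (K.mul_mem (K.inv_mem g.2) (hHK hh)) g.2
          simpa [mul_assoc] using this
        exact (hgN ⟨h, hhK⟩).2 hh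
    have hHN : H ≤ K ⊓ Subgroup.normalizer (H : Set G) := le_inf hHK Subgroup.le_normalizer
    refine Relation.ReflTransGen.head (b := K ⊓ Subgroup.normalizer (H : Set G))
      ⟨hHN, fun k hk h hh => (Subgroup.mem_normalizer_iff.mp hk.2 h).1 hh⟩
      (ih _ (lt_of_le_of_ne hHN fun h => hgH ?_) inf_le_left)
    show (g : G) ∈ H
    rw [h]
    exact ⟨g.2, hg⟩

theorem IsPGroup.le_subnormalizer [Finite G] [Fact p.Prime] {P : Subgroup G}
    (hP : IsPGroup p P) (hx : x ∈ P) : P ≤ subnormalizer x := fun g hg => by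
  have hle : Subgroup.closure {x, g} ≤ P := by
    rw [Subgroup.closure_le]
    rintro y (rfl | rfl) <;> assumption
  refine Subgroup.subset_closure ((hP.to_le hle).isSubnormalIn ?_)
  rw [Subgroup.zpowers_le]
  exact Subgroup.subset_closure (Set.mem_insert _ _)

theorem IsPGroup.le_subnormalizer_of_conj_mem [Finite G] [Fact p.Prime] {T : Subgroup G}
    (hx : IsPGroup p (Subgroup.zpowers x)) (hT : IsPGroup p T)
    (hn : ∀ t ∈ T, x * t * x⁻¹ ∈ T) : T ≤ subnormalizer x := by
  have hxN : Subgroup.zpowers x ≤ Subgroup.normalizer (T : Set G) := by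
    rw [Subgroup.zpowers_le]
    exact Subgroup.mem_normalizer_fintype hn
  exact le_sup_right.trans ((hx.to_sup_of_normal_right' hT hxN).le_subnormalizer
    (Subgroup.mem_sup_left (Subgroup.mem_zpowers x)))

theorem IsPGroup.le_subnormalizer_of_sq_conj_mem [Finite G] [Fact p.Prime] {Q : Subgroup G}
    (hx : IsPGroup p (Subgroup.zpowers x)) (hQ : IsPGroup p Q)
    (hn : ∀ t ∈ Q, x * (x * t * x⁻¹) * x⁻¹ ∈ Q)
    (hc : ∀ s ∈ Q, ∀ t ∈ Q, Commute s (x * t * x⁻¹)) : Q ≤ subnormalizer x := by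
  set R := Q.map (MulAut.conj x).toMonoidHom with hR
  have hRN : R ≤ Subgroup.normalizer (Q : Set G) := by
    rintro _ ⟨t, ht, rfl⟩
    refine Subgroup.mem_normalizer_fintype fun s hs => ?_
    have := (hc s hs t ht).eq
    simp only [MulEquiv.coe_toMonoidHom, MulAut.conj_apply]
    rw [← this, mul_inv_cancel_right]
    exact hs
  refine le_sup_left.trans (IsPGroup.le_subnormalizer_of_conj_mem hx
    (hQ.to_sup_of_normal_left' (hQ.map _) hRN) fun t ht => ?_)
  have hle : (Q ⊔ R).map (MulAut.conj x).toMonoidHom ≤ Q ⊔ R := by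
    rw [Subgroup.map_sup]
    refine sup_le le_sup_right (le_trans ?_ le_sup_left)
    rintro _ ⟨_, ⟨t, ht, rfl⟩, rfl⟩
    exact hn t ht
  exact hle ⟨t, ht, rfl⟩

/-- If `π` is the only point of its orbit fixed by `x`, then the subnormalizer of `x` fixes
`π`. -/
theorem subnormalizer_le_stabilizer {X : Type*} [MulAction G X] {π : X} (hπ : x • π = π)
    (huniq : ∀ g : G, x • g • π = g • π → g • π = π) :
    subnormalizer x ≤ MulAction.stabilizer G π := by
  refine (Subgroup.closure_le _).2 fun g hg => ?_
  suffices h : ∀ K, IsSubnormalIn (Subgroup.zpowers x) K →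
      x ∈ K ∧ K ≤ MulAction.stabilizer G π from
    (h _ hg).2 (Subgroup.subset_closure (Set.mem_insert_of_mem _ rfl))
  intro K hK
  induction hK with
  | refl => exact ⟨Subgroup.mem_zpowers x, by rwa [Subgroup.zpowers_le]⟩
  | tail _ hHK ih =>
    refine ⟨hHK.1 ih.1, fun h hh => huniq h ?_⟩
    have := ih.2 (hHK.2 h⁻¹ (inv_mem hh) x ih.1)
    rw [MulAction.mem_stabilizer_iff, inv_inv, mul_smul, mul_smul, inv_smul_eq_iff] at this
    exact this

end Group

section Perm

variable {α : Type*} {x : Equiv.Perm α}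

open Equiv Equiv.Perm

theorem zpow_apply_eq_iff_period_dvd {i j : ℤ} {a : α} :
    (x ^ i) a = (x ^ j) a ↔ (MulAction.period x a : ℤ) ∣ i - j := by
  rw [← MulAction.zpow_smul_eq_iff_period_dvd, sub_eq_neg_add, zpow_add, zpow_neg,
    mul_smul, inv_smul_eq_iff, Perm.smul_def, Perm.smul_def]

theorem period_zpow_apply (i : ℤ) (a : α) :
    MulAction.period x ((x ^ i) a) = MulAction.period x a := by
  refine (Nat.dvd_right_iff_eq.mp fun n => ?_)
  rw [← Int.natCast_dvd_natCast, ← Int.natCast_dvd_natCast (m := MulAction.period x a)]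
  have h := zpow_apply_eq_iff_period_dvd (x := x) (i := n) (j := 0) (a := a)
  have h' := zpow_apply_eq_iff_period_dvd (x := x) (i := n) (j := 0) (a := (x ^ i) a)
  rw [sub_zero] at h h'
  rw [← h, ← h', ← Perm.mul_apply, ← Perm.mul_apply, ← zpow_add, ← zpow_add, add_comm, add_comm 0,
    zpow_add, zpow_add, Perm.mul_apply, Perm.mul_apply, (x ^ i).injective.eq_iff]

theorem Equiv.Perm.SameCycle.period_eq {a b : α} (h : x.SameCycle a b) :
    MulAction.period x a = MulAction.period x b := by
  obtain ⟨i, rfl⟩ := h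
  exact (period_zpow_apply i a).symm

theorem card_filter_sameCycle [Fintype α] [DecidableEq α] (x : Perm α) (a : α) :
    (Finset.univ.filter (x.SameCycle a)).card = MulAction.period x a := by
  have hpos : 0 < MulAction.period x a :=
    MulAction.period_pos_of_orderOf_pos (orderOf_pos x) a
  have : Finset.univ.filter (x.SameCycle a) =
      (Finset.range (MulAction.period x a)).image fun i : ℕ => (x ^ i) a := by
    ext y
    simp only [Finset.mem_filter, Finset.mem_univ, true_and, Finset.mem_image, Finset.mem_range]
    constructor
    · rintro ⟨i, rfl⟩
      refine ⟨(i % MulAction.period x a).toNat, ?_, ?_⟩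
      · have := Int.emod_lt_of_pos i (Int.natCast_pos.2 hpos)
        have := Int.emod_nonneg i (Int.natCast_pos.2 hpos).ne'
        omega
      · have := Int.emod_nonneg i (Int.natCast_pos.2 hpos).ne'
        rw [← zpow_natCast, Int.toNat_of_nonneg this]
        exact MulAction.zpow_mod_period_smul (g := x) (a := a) i
    · rintro ⟨i, -, rfl⟩
      exact ⟨i, by simp⟩
  rw [this, Finset.card_image_of_injOn, Finset.card_range]
  intro i hi j hj hij
  simp only [Finset.coe_range, Set.mem_Iio] at hi hj
  have h : (x ^ (i : ℤ)) a = (x ^ (j : ℤ)) a := by simpa using hij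
  rw [zpow_apply_eq_iff_period_dvd] at h
  have := Int.eq_zero_of_abs_lt_dvd h (by rw [abs_lt]; omega)
  omega

/-- The permutations that move each point either trivially or as the involution `w` does. -/
def partialInvolutions (w : Perm α) (hw : Function.Involutive w) : Subgroup (Perm α) where
  carrier := {g | ∀ y, g y = y ∨ g y = w y}
  one_mem' _ := Or.inl rfl
  mul_mem' {g h} hg hh y := by
    rw [Perm.mul_apply]
    rcases hh y with h1 | h1 <;> rw [h1]
    · exact hg y
    · rcases hg (w y) with h2 | h2 <;> rw [h2]
      · exact Or.inr rfl
      · exact Or.inl (hw y)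
  inv_mem' {g} hg y := by
    rcases hg (g⁻¹ y) with h | h <;>
      rw [Perm.coe_inv, Equiv.apply_symm_apply] at h
    · exact Or.inl h.symm
    · exact Or.inr (hw.eq_iff.1 h.symm)

theorem isPGroup_partialInvolutions (w : Perm α) (hw : Function.Involutive w) :
    IsPGroup 2 (partialInvolutions w hw) := by
  rintro ⟨g, hg⟩
  refine ⟨1, Subtype.ext (Equiv.ext fun y => ?_)⟩
  show (g ^ (2 ^ 1)) y = y
  rw [pow_one, pow_two, Perm.mul_apply]
  rcases hg y with h | h
  · rw [h, h]
  · rw [h]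
    rcases hg (w y) with h' | h'
    · have := g.injective (h.trans h'.symm)
      rw [h', ← this]
    · rw [h', hw]

variable [Finite α]

theorem swap_mem_subnormalizer_of_commute [DecidableEq α]
    (hx : IsPGroup 2 (Subgroup.zpowers x)) {w : Perm α}
    (hw : Function.Involutive w) (hc : Commute x w) (a : α) :
    swap a (w a) ∈ subnormalizer x := by
  refine hx.le_subnormalizer_of_conj_mem (isPGroup_partialInvolutions w hw)
    (fun t ht y => ?_) (fun y => ?_)
  · have hcy : ∀ z, x (w z) = w (x z) := fun z => Equiv.congr_fun hc.eq z
    rw [Perm.mul_apply, Perm.mul_apply]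
    rcases ht (x⁻¹ y) with h | h <;> rw [h]
    · exact Or.inl (x.apply_symm_apply y)
    · rw [hcy, Perm.coe_inv, Equiv.apply_symm_apply]
      exact Or.inr rfl
  · rw [swap_apply_def]
    split_ifs with h1 h2
    · exact Or.inr (by rw [h1])
    · exact Or.inr (by rw [h2, hw])
    · exact Or.inl rfl

theorem swap_mem_subnormalizer_of_period_eq [DecidableEq α]
    (hx : IsPGroup 2 (Subgroup.zpowers x)) {a b : α}
    (hab : MulAction.period x a = MulAction.period x b) (hne : ¬ x.SameCycle a b) :
    swap a b ∈ subnormalizer x := by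
  classical
  let f : α → α := fun y =>
    if h : x.SameCycle a y then (x ^ h.choose) b
    else if h : x.SameCycle b y then (x ^ h.choose) a else y
  have hfa (i : ℤ) : f ((x ^ i) a) = (x ^ i) b := by
    have h : x.SameCycle a ((x ^ i) a) := ⟨i, rfl⟩
    simp only [f, dif_pos h]
    have := h.choose_spec
    rwa [zpow_apply_eq_iff_period_dvd, hab, ← zpow_apply_eq_iff_period_dvd] at this
  have hfb (i : ℤ) : f ((x ^ i) b) = (x ^ i) a := by
    have h : x.SameCycle b ((x ^ i) b) := ⟨i, rfl⟩
    have h' : ¬ x.SameCycle a ((x ^ i) b) := fun h' => hne (h'.trans h.symm)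
    simp only [f, dif_pos h, dif_neg h']
    have := h.choose_spec
    rwa [zpow_apply_eq_iff_period_dvd, ← hab, ← zpow_apply_eq_iff_period_dvd] at this
  have hf {y : α} (h1 : ¬ x.SameCycle a y) (h2 : ¬ x.SameCycle b y) : f y = y := by
    simp only [f, dif_neg h1, dif_neg h2]
  have hinv : Function.Involutive f := fun y => by
    by_cases h1 : x.SameCycle a y
    · obtain ⟨i, rfl⟩ := h1
      rw [hfa, hfb]
    by_cases h2 : x.SameCycle b y
    · obtain ⟨i, rfl⟩ := h2
      rw [hfb, hfa]
    rw [hf h1 h2, hf h1 h2]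
  have hcomm : Commute x hinv.toPerm := Equiv.ext fun y => by
    simp only [Perm.mul_apply, Function.Involutive.coe_toPerm]
    by_cases h1 : x.SameCycle a y
    · obtain ⟨i, rfl⟩ := h1
      simp only [hfa, ← Perm.mul_apply, ← zpow_one_add]
    by_cases h2 : x.SameCycle b y
    · obtain ⟨i, rfl⟩ := h2
      simp only [hfb, ← Perm.mul_apply, ← zpow_one_add]
    rw [hf h1 h2, hf (by simpa using h1) (by simpa using h2)]
  have := swap_mem_subnormalizer_of_commute hx hinv.toPerm_involutive hcomm a
  rwa [Function.Involutive.coe_toPerm, show f a = b from hfa 0] at this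

/-- Pigeonhole for cycles: if the cycles of `x` meeting `S` have lengths among
`1, 2, …, 2 ^ (m - 1)` and `S` has at least `2 ^ m` points, then two cycles meeting `S` have
the same length. -/
theorem exists_period_eq_not_sameCycle {m : ℕ} {S : Finset α}
    (hS : ∀ y ∈ S, ∃ i < m, MulAction.period x y = 2 ^ i) (hcard : 2 ^ m ≤ S.card) :
    ∃ p ∈ S, ∃ q ∈ S, MulAction.period x p = MulAction.period x q ∧ ¬ x.SameCycle p q := by
  classical
  have := Fintype.ofFinite α
  by_contra! hcon
  choose! e he hper using hS
  have hsum := Finset.card_eq_sum_card_fiberwise (f := e) (s := S) (t := Finset.range m)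
    fun y hy => by simpa using he y hy
  have hle : ∀ i ∈ Finset.range m, (S.filter fun y => e y = i).card ≤ 2 ^ i := by
    intro i _
    rcases (S.filter fun y => e y = i).eq_empty_or_nonempty with h | ⟨p, hp⟩
    · simp [h]
    rw [Finset.mem_filter] at hp
    rw [← hp.2, ← hper p hp.1, ← card_filter_sameCycle]
    refine Finset.card_le_card fun q hq => ?_
    rw [Finset.mem_filter] at hq
    simp only [Finset.mem_filter, Finset.mem_univ, true_and]
    refine hcon p hp.1 q hq.1 ?_
    rw [hper p hp.1, hper q hq.1, hq.2, hp.2]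
  have h1 := hsum.trans_le (Finset.sum_le_sum hle)
  have h2 := Nat.geomSum_lt (m := 2) (s := Finset.range m) (n := m) le_rfl
    fun i hi => Finset.mem_range.1 hi
  omega

end Perm

section Transitive

/-- A Sylow `p`-subgroup of a group acting transitively on a set of `p`-power size acts
transitively. -/
theorem Sylow.isPretransitive_of_card_eq_pow {H β : Type*} [Group H] [Finite H] [Finite β]
    [MulAction H β] [MulAction.IsPretransitive H β] {p : ℕ} [Fact p.Prime] {j : ℕ}
    (hβ : Nat.card β = p ^ j) (Q : Sylow p H) : MulAction.IsPretransitive Q β := by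
  have horbit (a : β) : MulAction.orbit Q a = Set.univ := by
    refine (Set.eq_univ_iff_ncard _).2 (le_antisymm (Set.ncard_le_card _) ?_)
    have h1 := MulAction.index_stabilizer_of_transitive H a
    have h2 := Subgroup.relIndex_mul_index
      (inf_le_right : MulAction.stabilizer H a ⊓ (Q : Subgroup H) ≤ Q)
    have h3 := Subgroup.index_dvd_of_le
      (inf_le_left : MulAction.stabilizer H a ⊓ (Q : Subgroup H) ≤ MulAction.stabilizer H a)
    have h4 : ((MulAction.stabilizer H a ⊓ (Q : Subgroup H)).relIndex Q) =
        (MulAction.orbit Q a).ncard := by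
      rw [Subgroup.inf_relIndex_right, ← MulAction.index_stabilizer]
      rfl
    rw [← h2, h1, h4, hβ] at h3
    have hco : (p ^ j).Coprime (Q : Subgroup H).index :=
      (Nat.Prime.coprime_iff_not_dvd Fact.out).2 Q.not_dvd_index |>.pow_left j
    rw [hβ]
    exact Nat.le_of_dvd ((Set.ncard_pos (Set.toFinite _)).2 (MulAction.nonempty_orbit a))
      (hco.dvd_of_dvd_mul_right h3)
  refine ⟨fun a b => ?_⟩
  have : b ∈ MulAction.orbit Q a := horbit a ▸ Set.mem_univ b
  exact this

open Equiv Equiv.Perm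

variable {α : Type*} {x : Perm α}

theorem IsPGroup.zpowers_subtypePerm {p : ℕ} [Fact p.Prime]
    (hx : IsPGroup p (Subgroup.zpowers x)) {A : Set α} (hA : ∀ a, x a ∈ A ↔ a ∈ A) :
    IsPGroup p (Subgroup.zpowers (x.subtypePerm hA)) := by
  obtain ⟨n, hn⟩ := IsPGroup.iff_orderOf.1 hx ⟨x, Subgroup.mem_zpowers x⟩
  have hxn : x ^ p ^ n = 1 := by
    rw [← hn, Subgroup.orderOf_mk, pow_orderOf_eq_one]
  have hyn : x.subtypePerm hA ^ p ^ n = 1 := by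
    ext a
    simp [Perm.subtypePerm_pow, hxn]
  obtain ⟨i, -, hi⟩ := (Nat.dvd_prime_pow Fact.out).1 (orderOf_dvd_of_pow_eq_one hyn)
  exact IsPGroup.of_card (n := i) (by rw [Nat.card_zpowers, hi])

variable [Finite α]

theorem exists_isPGroup_transitive_on {p : ℕ} [Fact p.Prime]
    (hx : IsPGroup p (Subgroup.zpowers x)) {A : Set α} (hA : ∀ a, x a ∈ A ↔ a ∈ A) {j : ℕ}
    (hj : A.ncard = p ^ j) :
    ∃ Q : Subgroup (Perm α), IsPGroup p Q ∧ (∀ t ∈ Q, x * t * x⁻¹ ∈ Q) ∧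
      (∀ t ∈ Q, ∀ z ∉ A, t z = z) ∧ ∀ a ∈ A, ∀ b ∈ A, ∃ t ∈ Q, t a = b := by
  classical
  let y : Perm A := x.subtypePerm hA
  have hy := hx.zpowers_subtypePerm hA
  obtain ⟨Q, hQ⟩ := hy.exists_le_sylow
  have hyQ : y ∈ Q := hQ (Subgroup.mem_zpowers y)
  have := Q.isPretransitive_of_card_eq_pow (β := A) hj
  refine ⟨(Q : Subgroup (Perm A)).map Perm.ofSubtype, Q.2.map _, ?_, ?_, ?_⟩
  · rintro _ ⟨q, hq, rfl⟩
    refine ⟨y * q * y⁻¹, mul_mem (mul_mem hyQ hq) (inv_mem hyQ), Equiv.ext fun z => ?_⟩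
    obtain ⟨z, rfl⟩ := x.surjective z
    simp only [Perm.mul_apply, Perm.coe_inv, Equiv.symm_apply_apply]
    by_cases hz : z ∈ A
    · have hyz : (⟨x z, (hA z).2 hz⟩ : A) = y ⟨z, hz⟩ := rfl
      rw [Perm.ofSubtype_apply_of_mem _ ((hA z).2 hz), Perm.ofSubtype_apply_of_mem _ hz, hyz]
      simp [y]
    · rw [Perm.ofSubtype_apply_of_not_mem _ (fun h => hz ((hA z).1 h)),
        Perm.ofSubtype_apply_of_not_mem _ hz]
  · rintro _ ⟨q, -, rfl⟩ z hz
    exact Perm.ofSubtype_apply_of_not_mem _ hz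
  · intro a ha b hb
    obtain ⟨⟨q, hq⟩, hqa⟩ := MulAction.exists_smul_eq Q (⟨a, ha⟩ : A) ⟨b, hb⟩
    refine ⟨Perm.ofSubtype q, ⟨q, hq, rfl⟩, ?_⟩
    rw [Perm.ofSubtype_apply_of_mem _ ha]
    exact congrArg Subtype.val hqa

/-- On an `x`-invariant set of `p`-power size, `subnormalizer x` acts transitively by elements
fixing all other points. -/
theorem exists_mem_subnormalizer_of_invariant {p : ℕ} [Fact p.Prime]
    (hx : IsPGroup p (Subgroup.zpowers x)) {A : Set α} (hA : ∀ a, x a ∈ A ↔ a ∈ A) {j : ℕ}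
    (hj : A.ncard = p ^ j) {a b : α} (ha : a ∈ A) (hb : b ∈ A) :
    ∃ t ∈ subnormalizer x, t a = b ∧ ∀ z ∉ A, t z = z := by
  obtain ⟨Q, hQ, hn, hfix, htrans⟩ := exists_isPGroup_transitive_on hx hA hj
  obtain ⟨t, ht, hta⟩ := htrans a ha b hb
  exact ⟨t, hx.le_subnormalizer_of_conj_mem hQ hn ht, hta, hfix t ht⟩

/-- On a set of `p`-power size that `x` exchanges with its complement, `subnormalizer x` acts
transitively by elements fixing all other points. -/
theorem exists_mem_subnormalizer_of_exchanged {p : ℕ} [Fact p.Prime]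
    (hx : IsPGroup p (Subgroup.zpowers x)) {A : Set α} (hA : ∀ a, x a ∈ A ↔ a ∉ A) {j : ℕ}
    (hj : A.ncard = p ^ j) {a b : α} (ha : a ∈ A) (hb : b ∈ A) :
    ∃ t ∈ subnormalizer x, t a = b ∧ ∀ z ∉ A, t z = z := by
  obtain ⟨Q, hQ, hn, hfix, htrans⟩ := exists_isPGroup_transitive_on (x := x * x)
    (hx.to_le (Subgroup.zpowers_le.2 (mul_mem (Subgroup.mem_zpowers x) (Subgroup.mem_zpowers x))))
    (A := A) (fun a => by rw [Perm.mul_apply, hA, hA, not_not]) hj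
  obtain ⟨t, ht, hta⟩ := htrans a ha b hb
  refine ⟨t, hx.le_subnormalizer_of_sq_conj_mem hQ (fun s hs => ?_) (fun s hs r hr => ?_) ht,
    hta, hfix t ht⟩
  · simpa [mul_assoc] using hn s hs
  · refine Perm.Disjoint.commute fun z => ?_
    obtain ⟨z, rfl⟩ := x.surjective z
    by_cases hz : z ∈ A
    · exact Or.inl (hfix s hs _ fun h => (hA z).1 h hz)
    · exact Or.inr (by simp [hfix r hr z hz])

end Transitive

section Full

open Equiv Equiv.Perm
open scoped Pointwise

theorem isPGroup_zpowers_of_orderOf_eq {G : Type*} [Group G] {x : G} {p m : ℕ}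
    [Fact p.Prime] (hx : orderOf x = p ^ m) : IsPGroup p (Subgroup.zpowers x) :=
  IsPGroup.of_card (n := m) (by rw [Nat.card_zpowers, hx])

theorem Nat.not_two_dvd_choose_two_pow_sub_one {d i : ℕ} (hi : i < 2 ^ d) :
    ¬ 2 ∣ (2 ^ d - 1).choose i := by
  induction i with
  | zero => simp
  | succ i ih =>
    have h1 := Nat.Prime.dvd_choose_pow (n := d) Nat.prime_two (Nat.succ_ne_zero i) hi.ne
    have h2 : (2 ^ d).choose (i + 1) = (2 ^ d - 1).choose i + (2 ^ d - 1).choose (i + 1) := by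
      rw [← Nat.choose_succ_succ', Nat.sub_add_cancel Nat.one_le_two_pow]
    have h3 := ih (by omega)
    rw [Nat.succ_eq_add_one] at h1
    omega

theorem Subgroup.eq_top_of_swap_mem {α : Type*} [Finite α] [DecidableEq α]
    {M : Subgroup (Perm α)} (b : α) (h : ∀ y, swap b y ∈ M) : M = ⊤ := by
  rw [eq_top_iff, ← closure_isSwap, Subgroup.closure_le]
  rintro _ ⟨y, z, -, rfl⟩
  refine SubmonoidClass.swap_mem_trans M (b := b) ?_ (h z)
  rw [swap_comm]
  exact h y

variable {α : Type*} {x : Perm α}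

theorem Equiv.Perm.SameCycle.mem_iff_of_invariant {A : Set α} (hA : ∀ a, x a ∈ A ↔ a ∈ A)
    {a b : α} (h : x.SameCycle a b) : b ∈ A ↔ a ∈ A := by
  obtain ⟨i, rfl⟩ := h
  induction i with
  | zero => simp
  | succ i ih => rwa [add_comm, zpow_one_add, Perm.mul_apply, hA]
  | pred i ih =>
    rw [← hA, ← Perm.mul_apply, ← zpow_one_add, add_sub_cancel]
    exact ih

/-- If all cycles of `x` have even length, some set is exchanged by `x` with its complement. -/
theorem exists_exchanged_set (hx : ∀ a : α, 2 ∣ MulAction.period x a) :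
    ∃ A : Set α, ∀ a, x a ∈ A ↔ a ∉ A := by
  let s : α → α := fun y => Quotient.out (Quotient.mk (SameCycle.setoid x) y)
  have hs (y : α) : x.SameCycle (s y) y := Quotient.mk_out (s := SameCycle.setoid x) y
  have hsx (y : α) : s (x y) = s y :=
    congrArg Quotient.out (Quotient.sound (s := SameCycle.setoid x)
      (show x.SameCycle (x y) y from (sameCycle_apply_left).2 (SameCycle.refl x y)))
  have hmem (y z : α) (i : ℤ) (hi : (x ^ i) z = y) :
      (∃ j : ℤ, Even j ∧ (x ^ j) z = y) ↔ Even i := by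
    refine ⟨?_, fun h => ⟨i, h, hi⟩⟩
    rintro ⟨j, hj, hjy⟩
    rw [← hi, zpow_apply_eq_iff_period_dvd] at hjy
    have h2 : (2 : ℤ) ∣ j - i := (Int.natCast_dvd_natCast.2 (hx z)).trans hjy
    rw [Int.even_iff] at hj ⊢
    omega
  refine ⟨{y | ∃ j : ℤ, Even j ∧ (x ^ j) (s y) = y}, fun y => ?_⟩
  obtain ⟨i, hi⟩ := hs y
  rw [Set.mem_ofPred_eq, Set.mem_ofPred_eq, hsx, hmem y (s y) i hi, hmem (x y) (s y) (1 + i)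
    (by rw [zpow_one_add, Perm.mul_apply, hi]), Int.even_add]
  simp

theorem exists_invariant_subset_ncard_eq {S : Set α}
    (hx : IsPGroup 2 (Subgroup.zpowers x)) (hS : ∀ a, x a ∈ S ↔ a ∈ S) {d i : ℕ}
    (hd : S.ncard = 2 ^ d - 1) (hi : i < 2 ^ d) :
    ∃ B ⊆ S, B.ncard = i ∧ ∀ a, x a ∈ B ↔ a ∈ B := by
  classical
  let y : Perm S := x.subtypePerm hS
  have hcard : ¬ 2 ∣ Nat.card (Set.powersetCard S i) := by
    rw [Set.powersetCard.card, Nat.card_coe_set_eq, hd]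
    exact Nat.not_two_dvd_choose_two_pow_sub_one hi
  obtain ⟨B, hB⟩ :=
    (hx.zpowers_subtypePerm hS).nonempty_fixed_point_of_prime_not_dvd_card _ hcard
  have hyB : y • (B : Finset S) = B := congrArg Subtype.val (hB ⟨y, Subgroup.mem_zpowers y⟩)
  have key (b : S) : y b ∈ (B : Finset S) ↔ b ∈ (B : Finset S) := by
    conv_lhs => rw [← hyB]
    exact Finset.smul_mem_smul_finset_iff y
  refine ⟨Subtype.val '' ((B : Finset S) : Set S), by simp, ?_, fun a => ?_⟩
  · rw [Set.ncard_image_of_injective _ Subtype.val_injective, Set.ncard_coe_finset,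
      Set.powersetCard.card_eq]
  · constructor
    · rintro ⟨⟨_, h⟩, hb, rfl⟩
      exact ⟨⟨a, (hS a).1 h⟩, (key ⟨a, (hS a).1 h⟩).1 hb, rfl⟩
    · rintro ⟨b, hb, rfl⟩
      exact ⟨y b, (key b).2 hb, rfl⟩

variable [Finite α]

theorem ncard_exchanged_set {A : Set α} (hA : ∀ a, x a ∈ A ↔ a ∉ A) :
    2 * A.ncard = Nat.card α := by
  have h1 : x '' A = Aᶜ := by
    ext y
    obtain ⟨y, rfl⟩ := x.surjective y
    rw [x.injective.mem_set_image, Set.mem_compl_iff, hA, not_not]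
  have h2 := Set.ncard_add_ncard_compl A
  rw [← h1, Set.ncard_image_of_injective _ x.injective] at h2
  omega

theorem subnormalizer_eq_top_of_no_fixed_point {k m : ℕ} (hα : Nat.card α = 2 ^ k)
    (hx : orderOf x = 2 ^ m) (hfree : ∀ a, x a ≠ a) {a b : α}
    (hab : MulAction.period x a = MulAction.period x b) (hne : ¬ x.SameCycle a b) :
    subnormalizer x = ⊤ := by
  classical
  have hp := isPGroup_zpowers_of_orderOf_eq hx
  obtain ⟨A, hA⟩ := exists_exchanged_set (x := x) fun a => by
    obtain ⟨i, -, hi⟩ := (Nat.dvd_prime_pow Nat.prime_two).1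
      (hx ▸ MulAction.period_dvd_orderOf x a)
    rw [hi]
    refine dvd_pow_self 2 fun h => hfree a ?_
    rw [h, pow_zero, MulAction.period_eq_one_iff] at hi
    exact hi
  obtain ⟨j, hj⟩ : ∃ j, A.ncard = 2 ^ j := by
    have h := ncard_exchanged_set hA
    rw [hα] at h
    cases k with
    | zero => omega
    | succ k => exact ⟨k, by rw [pow_succ] at h; omega⟩
  have hAc : ∀ a, x a ∈ Aᶜ ↔ a ∉ Aᶜ := fun a => by simp [hA]
  have hjc : Aᶜ.ncard = 2 ^ j := by
    have h := ncard_exchanged_set hA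
    have h' := ncard_exchanged_set hAc
    omega
  have main : ∀ a ∈ A, ∀ b ∉ A, swap a b ∈ subnormalizer x → subnormalizer x = ⊤ := by
    intro a ha b hb hab
    refine Subgroup.eq_top_of_swap_mem b fun y => ?_
    have hA' (y : α) (hy : y ∈ A) : swap y b ∈ subnormalizer x := by
      obtain ⟨t, ht, hta, hfix⟩ := exists_mem_subnormalizer_of_exchanged hp hA hj ha hy
      rw [← hta, ← hfix b hb, swap_apply_apply]
      exact mul_mem (mul_mem ht hab) (inv_mem ht)
    by_cases hy : y ∈ A
    · rw [swap_comm]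
      exact hA' y hy
    · obtain ⟨t, ht, hta, hfix⟩ := exists_mem_subnormalizer_of_exchanged hp hAc hjc hb hy
      refine SubmonoidClass.swap_mem_trans (b := a) _ (by rwa [swap_comm]) ?_
      rw [← hta, ← hfix a (by simpa using ha), swap_apply_apply]
      exact mul_mem (mul_mem ht hab) (inv_mem ht)
  obtain ⟨c, hc, hac⟩ : ∃ c, swap a c ∈ subnormalizer x ∧ (a ∈ A ↔ c ∉ A) := by
    by_cases h : a ∈ A ↔ b ∉ A
    · exact ⟨b, swap_mem_subnormalizer_of_period_eq hp hab hne, h⟩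
    · refine ⟨x b, swap_mem_subnormalizer_of_period_eq hp ?_ ?_, ?_⟩
      · rw [hab]
        exact SameCycle.period_eq (sameCycle_apply_right.2 (SameCycle.refl x b))
      · rwa [sameCycle_apply_right]
      · rw [hA]
        tauto
  by_cases ha : a ∈ A
  · exact main a ha c (hac.1 ha) hc
  · exact main c (by tauto) a ha (by rwa [swap_comm])

theorem subnormalizer_eq_top_of_fixed_point {k m : ℕ} (hα : Nat.card α = 2 ^ k)
    (hx : orderOf x = 2 ^ m) {u : α} (hu : x u = u)
    (hper : ∀ y : α, ∃ i < k - 1, MulAction.period x y = 2 ^ i) : subnormalizer x = ⊤ := by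
  classical
  have := Fintype.ofFinite α
  have hp := isPGroup_zpowers_of_orderOf_eq hx
  by_contra hcon
  set M := subnormalizer x with hM
  let C : α → Set α := fun a => {y | swap a y ∈ M}
  have hCself (a : α) : a ∈ C a := by
    show swap a a ∈ M
    rw [swap_self]
    exact M.one_mem
  have hCeq {a b : α} (h : b ∈ C a) : C b = C a := by
    ext y
    have h' : swap b a ∈ M := by rw [swap_comm]; exact h
    exact ⟨fun hy => SubmonoidClass.swap_mem_trans M h hy,
      fun hy => SubmonoidClass.swap_mem_trans M h' hy⟩
  have hCsmul (g : M) (a : α) : g • C a = C (g.1 a) := by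
    ext y
    obtain ⟨y, rfl⟩ := g.1.surjective y
    have : g.1 y ∈ g • C a ↔ y ∈ C a := Set.smul_mem_smul_set_iff (a := g)
    rw [this]
    show swap a y ∈ M ↔ swap (g.1 a) (g.1 y) ∈ M
    rw [swap_apply_apply, M.mul_mem_cancel_right (inv_mem g.2), M.mul_mem_cancel_left g.2]
  have : MulAction.IsPretransitive M α := ⟨fun a b => by
    obtain ⟨t, ht, hta, -⟩ := exists_mem_subnormalizer_of_invariant hp (A := Set.univ)
      (by simp) (j := k) (by rw [Set.ncard_univ, hα]) (Set.mem_univ a) (Set.mem_univ b)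
    exact ⟨⟨t, ht⟩, hta⟩⟩
  have hblock : MulAction.IsBlock M (C u) := by
    refine MulAction.isBlock_iff_smul_eq_or_disjoint.2 fun g => ?_
    rw [hCsmul, or_iff_not_imp_right, Set.not_disjoint_iff]
    rintro ⟨y, hy, hy'⟩
    rw [← hCeq hy, hCeq hy']
  obtain ⟨d, hdk, hd⟩ := (Nat.dvd_prime_pow Nat.prime_two).1
    (hα ▸ hblock.ncard_dvd_card ⟨u, hCself u⟩)
  have hCcard (a : α) : (C a).ncard = 2 ^ d := by
    obtain ⟨g, rfl⟩ := MulAction.exists_smul_eq M u a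
    have h := hCsmul g u
    rw [← hd, show g • u = g.1 u from rfl, ← h, Set.ncard_smul_set]
  have hdlt : d < k := by
    refine lt_of_le_of_ne hdk fun h => hcon (Subgroup.eq_top_of_swap_mem u fun y => ?_)
    have huniv : C u = Set.univ := (Set.eq_univ_iff_ncard _).2 (by rw [hd, hα, h])
    have hy : y ∈ C u := by rw [huniv]; trivial
    exact hy
  obtain ⟨q, hq, t, ht, hqt⟩ : ∃ q ∉ C u, ∃ t < d, MulAction.period x q = 2 ^ t := by
    by_contra! hlarge
    have hS : 2 ^ (k - 1) ≤ (C u)ᶜ.toFinset.card := by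
      rw [← Set.ncard_eq_toFinset_card']
      have h1 := Set.ncard_add_ncard_compl (C u)
      have h2 : 2 ^ d ≤ 2 ^ (k - 1) := Nat.pow_le_pow_right two_pos (by omega)
      have h3 : 2 ^ k = 2 ^ (k - 1) * 2 := by rw [← pow_succ, Nat.sub_add_cancel (by omega)]
      omega
    obtain ⟨a, ha, b, -, hab, hne⟩ := exists_period_eq_not_sameCycle (fun y _ => hper y) hS
    obtain ⟨i, -, hi⟩ := hper a
    have hid : d ≤ i := by
      by_contra! h
      exact hlarge a (by simpa using ha) i h hi
    have hsub : insert a {y | x.SameCycle b y} ⊆ C a := by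
      rintro y (rfl | hy)
      · exact hCself y
      · exact swap_mem_subnormalizer_of_period_eq hp (hab.trans (SameCycle.period_eq hy))
          fun h => hne (h.trans hy.symm)
    have hle := Set.ncard_le_ncard hsub
    have hnot : a ∉ {y | x.SameCycle b y} := fun h => hne (SameCycle.symm h)
    rw [Set.ncard_insert_of_notMem hnot, hCcard,
      Set.ncard_eq_toFinset_card', Set.toFinset_ofPred, card_filter_sameCycle, ← hab, hi] at hle
    have := Nat.pow_le_pow_right two_pos hid
    omega
  have hxM : x ∈ M := mem_subnormalizer_self x
  have hxC (a : α) : x a ∈ C u ↔ a ∈ C u := by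
    show swap u (x a) ∈ M ↔ swap u a ∈ M
    conv_lhs => rw [← hu, swap_apply_apply, M.mul_mem_cancel_right (inv_mem hxM),
      M.mul_mem_cancel_left hxM]
  have hxCu (a : α) : x a ∈ C u \ {u} ↔ a ∈ C u \ {u} := by
    rw [Set.mem_sdiff, Set.mem_sdiff, hxC, Set.mem_singleton_iff, Set.mem_singleton_iff]
    nth_rewrite 2 [← hu]
    rw [x.injective.eq_iff]
  obtain ⟨B, hBsub, hBcard, hB⟩ := exists_invariant_subset_ncard_eq hp hxCu (d := d)
    (i := 2 ^ t) (by rw [Set.ncard_sdiff_singleton_of_mem (hCself u), hd])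
    (Nat.pow_lt_pow_right one_lt_two ht)
  have hqB : Disjoint B {y | x.SameCycle q y} := by
    exact Set.disjoint_left.2 fun y hy hqy =>
      hq ((SameCycle.mem_iff_of_invariant hxC hqy).1 (hBsub hy).1)
  have hAcard : (B ∪ {y | x.SameCycle q y}).ncard = 2 ^ (t + 1) := by
    rw [Set.ncard_union_eq hqB, hBcard, Set.ncard_eq_toFinset_card', Set.toFinset_ofPred,
      card_filter_sameCycle, hqt, pow_succ, mul_two]
  obtain ⟨b, hb⟩ : B.Nonempty := Set.nonempty_of_ncard_ne_zero (by rw [hBcard]; positivity)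
  obtain ⟨g, hg, hgb, hfix⟩ := exists_mem_subnormalizer_of_invariant hp
    (A := B ∪ {y | x.SameCycle q y}) (fun a => by simp [hB, sameCycle_apply_right]) hAcard
    (Or.inl hb) (Or.inr (SameCycle.refl x q))
  refine hq ?_
  have hgu : g u = u := by
    refine hfix u ?_
    rintro (h | h)
    · exact (hBsub h).2 rfl
    · exact hq ((SameCycle.mem_iff_of_invariant hxC h).1 (hCself u))
  show swap u q ∈ M
  rw [← hgu, ← hgb, swap_apply_apply]
  exact mul_mem (mul_mem hg (hBsub hb).1) (inv_mem hg)

end Full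

section Proper

open Equiv Equiv.Perm
open scoped Pointwise

variable {α : Type*} {x : Perm α}

theorem smul_set_eq_self_iff_forall {C : Set α} : x • C = C ↔ ∀ a, x a ∈ C ↔ a ∈ C := by
  refine ⟨fun h a => ?_, fun h => Set.ext fun a => ?_⟩
  · conv_lhs => rw [← h]
    exact Set.smul_mem_smul_set_iff (a := x)
  · obtain ⟨a, rfl⟩ := x.surjective a
    rw [h]
    exact Set.smul_mem_smul_set_iff (a := x)

theorem smul_set_eq_compl_iff_forall {C : Set α} : x • C = Cᶜ ↔ ∀ a, x a ∈ C ↔ a ∉ C := by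
  refine ⟨fun h a => ?_, fun h => Set.ext fun a => ?_⟩
  · have : x a ∈ x • C ↔ a ∈ C := Set.smul_mem_smul_set_iff (a := x)
    rw [← this, h, Set.mem_compl_iff, not_not]
  · obtain ⟨a, rfl⟩ := x.surjective a
    rw [Set.mem_compl_iff, h, not_not]
    exact Set.smul_mem_smul_set_iff (a := x)

variable [Finite α]

/-- If `{A, Aᶜ}` is the only partition of `α` into two halves of equal size that `x` preserves,
then `subnormalizer x` is proper. -/
theorem subnormalizer_ne_top_of_unique_halving (hα : 2 < Nat.card α) {A : Set α}
    (hcard : 2 * A.ncard = Nat.card α) (hA : x • A = A ∨ x • A = Aᶜ)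
    (huniq : ∀ C : Set α, C.ncard = A.ncard → x • C = C ∨ x • C = Cᶜ → C = A ∨ C = Aᶜ) :
    subnormalizer x ≠ ⊤ := by
  classical
  have hpair (g : Perm α) (C : Set α) : g • ({C, Cᶜ} : Set (Set α)) = {g • C, (g • C)ᶜ} := by
    rw [← Set.smul_set_compl, ← Set.image_smul, Set.image_pair]
  have hfix {g : Perm α} {C : Set α} : g • ({C, Cᶜ} : Set (Set α)) = {C, Cᶜ} ↔
      g • C = C ∨ g • C = Cᶜ := by
    rw [hpair]
    refine ⟨fun h => ?_, ?_⟩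
    · have : g • C ∈ ({C, Cᶜ} : Set (Set α)) := h ▸ Set.mem_insert _ _
      exact this
    · rintro (h | h) <;> rw [h]
      rw [compl_compl, Set.pair_comm]
  have hstab := subnormalizer_le_stabilizer (x := x) (π := ({A, Aᶜ} : Set (Set α)))
    (hfix.2 hA) fun g hg => by
      rw [hpair, hfix] at hg
      exact hfix.2 (huniq _ (Set.ncard_smul_set g A) hg)
  intro htop
  have hcompl := Set.ncard_add_ncard_compl A
  obtain ⟨a, b, ha, hb, hab⟩ := (Set.one_lt_ncard_iff (s := A)).1 (by omega)
  obtain ⟨d, hd⟩ : Aᶜ.Nonempty := Set.nonempty_of_ncard_ne_zero (by omega)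
  have hs : swap b d • A = A ∨ swap b d • A = Aᶜ :=
    hfix.1 (hstab (htop ▸ Subgroup.mem_top (swap b d)))
  have hmem {c : α} (hc : c ∈ A) : swap b d c ∈ swap b d • A := Set.smul_mem_smul_set hc
  rcases hs with h | h
  · have := hmem hb
    rw [h, swap_apply_left] at this
    exact hd this
  · have := hmem ha
    rw [h, swap_apply_of_ne_of_ne hab (by rintro rfl; exact hd ha)] at this
    exact this ha

theorem subnormalizer_ne_top_of_sameCycle (hα : 2 < Nat.card α)
    (heven : ∀ a : α, 2 ∣ MulAction.period x a) (hx : ∀ a b, x.SameCycle a b) :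
    subnormalizer x ≠ ⊤ := by
  have htriv {C : Set α} (hC : ∀ a, x a ∈ C ↔ a ∈ C) : C = ∅ ∨ C = Set.univ := by
    rcases C.eq_empty_or_nonempty with h | ⟨a, ha⟩
    · exact Or.inl h
    · exact Or.inr (Set.eq_univ_of_forall fun b => ((hx a b).mem_iff_of_invariant hC).2 ha)
  obtain ⟨A, hA⟩ := exists_exchanged_set heven
  have hcard := ncard_exchanged_set hA
  refine subnormalizer_ne_top_of_unique_halving hα hcard
    (Or.inr (smul_set_eq_compl_iff_forall.2 hA)) ?_
  rintro C hCA (hC | hC)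
  · rcases htriv (smul_set_eq_self_iff_forall.1 hC) with rfl | rfl
    · rw [Set.ncard_empty] at hCA
      omega
    · rw [Set.ncard_univ] at hCA
      omega
  · rw [smul_set_eq_compl_iff_forall] at hC
    have hD := htriv (C := {a | a ∈ C ↔ a ∈ A}) fun a => by
      simp only [Set.mem_ofPred_eq, hC, hA, not_iff_not]
    rcases hD with hD | hD
    · refine Or.inr (Set.ext fun a => ?_)
      have : ¬ (a ∈ C ↔ a ∈ A) := Set.eq_empty_iff_forall_notMem.1 hD a
      rw [Set.mem_compl_iff]
      tauto
    · exact Or.inl (Set.ext (Set.eq_univ_iff_forall.1 hD))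

theorem subnormalizer_ne_top_of_fixed_point (hα : 2 < Nat.card α) {u : α} (hu : x u = u) {y : α}
    (hy : 2 * MulAction.period x y = Nat.card α) : subnormalizer x ≠ ⊤ := by
  classical
  have := Fintype.ofFinite α
  have hcard : 2 * {z | x.SameCycle y z}.ncard = Nat.card α := by
    rw [Set.ncard_eq_toFinset_card', Set.toFinset_ofPred, card_filter_sameCycle, hy]
  refine subnormalizer_ne_top_of_unique_halving hα hcard
    (Or.inl (smul_set_eq_self_iff_forall.2 fun a => sameCycle_apply_right)) ?_
  rintro C hCA (hC | hC)
  · rw [smul_set_eq_self_iff_forall] at hC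
    by_cases hyC : y ∈ C
    · exact Or.inl (Set.eq_of_subset_of_ncard_le
        (fun z hz => (SameCycle.mem_iff_of_invariant hC hz).2 hyC) hCA.le).symm
    · refine Or.inr (eq_compl_comm.1 (Set.eq_of_subset_of_ncard_le
        (fun z hz => mt (SameCycle.mem_iff_of_invariant hC hz).1 hyC) ?_))
      have := Set.ncard_add_ncard_compl C
      omega
  · have := smul_set_eq_compl_iff_forall.1 hC u
    rw [hu] at this
    tauto

end Proper

section Cycle

open Equiv Equiv.Perm

theorem forall_sameCycle_of_period_eq_card {α : Type*} [Finite α] {x : Perm α} {a : α}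
    (ha : MulAction.period x a = Nat.card α) (b : α) : x.SameCycle a b := by
  classical
  have := Fintype.ofFinite α
  rw [← card_filter_sameCycle x a, Nat.card_eq_fintype_card, Finset.card_eq_iff_eq_univ] at ha
  simpa using Finset.eq_univ_iff_forall.1 ha b

theorem cycleType_eq_singleton_card_iff {α : Type*} [Fintype α] [DecidableEq α] [Nontrivial α]
    {x : Perm α} :
    x.cycleType = {Fintype.card α} ↔ ∃ a : α, MulAction.period x a = Fintype.card α := by
  constructor
  · intro h
    have hc : x.IsCycle := card_cycleType_eq_one.1 (by rw [h, Multiset.card_singleton])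
    rw [hc.cycleType, Multiset.singleton_inj, Finset.card_eq_iff_eq_univ] at h
    obtain ⟨a, ha, hsame⟩ := hc
    refine ⟨a, ?_⟩
    rw [← card_filter_sameCycle x a, Finset.card_eq_iff_eq_univ, Finset.eq_univ_iff_forall]
    intro b
    simpa using hsame (mem_support.1 (h ▸ Finset.mem_univ b))
  · rintro ⟨a, ha⟩
    have hsame := forall_sameCycle_of_period_eq_card (ha.trans Nat.card_eq_fintype_card.symm)
    have hxa : x a ≠ a := fun h => by
      rw [MulAction.period_eq_one_iff.2 (show x • a = a from h)] at ha
      exact Fintype.one_lt_card.ne ha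
    have hc : x.IsCycle := ⟨a, hxa, fun b _ => hsame b⟩
    rw [hc.cycleType, Multiset.singleton_inj, Finset.card_eq_iff_eq_univ,
      Finset.eq_univ_iff_forall]
    intro b
    rw [mem_support, Ne, ← (hsame b).apply_eq_self_iff]
    exact hxa

theorem exists_period_eq_orderOf {G α : Type*} [Group G] [MulAction G α] [FaithfulSMul G α]
    [Nonempty α] {x : G} {p m : ℕ} [Fact p.Prime] (hx : orderOf x = p ^ m) :
    ∃ a : α, MulAction.period x a = orderOf x := by
  by_contra! hcon
  cases m with
  | zero =>
    obtain ⟨a⟩ := ‹Nonempty α›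
    refine hcon a (Nat.dvd_antisymm (MulAction.period_dvd_orderOf x a) ?_)
    rw [hx, pow_zero]
    exact one_dvd _
  | succ m =>
    have hpow : x ^ p ^ m = 1 := eq_of_smul_eq_smul (α := α) fun a => by
      obtain ⟨i, hi, hpi⟩ := (Nat.dvd_prime_pow Fact.out).1
        (hx ▸ MulAction.period_dvd_orderOf x a)
      rw [one_smul, MulAction.pow_smul_eq_iff_period_dvd, hpi]
      refine pow_dvd_pow p (Nat.le_of_lt_succ (lt_of_le_of_ne hi fun h => hcon a ?_))
      rw [hpi, hx, h]
    have h := orderOf_dvd_of_pow_eq_one hpow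
    rw [hx, Nat.pow_dvd_pow_iff_le_right (Nat.Prime.one_lt Fact.out)] at h
    omega

end Cycle

/-- For `k ≥ 3` and a `2`-element `x ∈ S_{2^k}`, the subnormalizer of `x` is a proper
subgroup if and only if `x` is a `2^k`-cycle, or `x` has order `2^{k-1}` and at least
one fixed point. -/
theorem subnormalizer_proper_iff (k : ℕ) (hk : 3 ≤ k) (x : Equiv.Perm (Fin (2 ^ k)))
    (hx : ∃ m, orderOf x = 2 ^ m) :
    subnormalizer x ≠ ⊤ ↔
      (x.cycleType = {2 ^ k} ∨ (orderOf x = 2 ^ (k - 1) ∧ ∃ a, x a = a)) := by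
  obtain ⟨m, hm⟩ := hx
  have hcard : Nat.card (Fin (2 ^ k)) = 2 ^ k := Nat.card_fin _
  have h2k : 2 ^ k = 2 * 2 ^ (k - 1) := by rw [← pow_succ', Nat.sub_add_cancel (by omega)]
  have hlarge : 2 < Nat.card (Fin (2 ^ k)) := by
    rw [hcard]
    exact lt_of_lt_of_le (by norm_num) (Nat.pow_le_pow_right two_pos hk)
  have : Nontrivial (Fin (2 ^ k)) := Finite.one_lt_card_iff_nontrivial.1 (by omega)
  have hcycle : x.cycleType = {2 ^ k} ↔ ∃ a : Fin (2 ^ k), MulAction.period x a = 2 ^ k := by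
    have h := cycleType_eq_singleton_card_iff (x := x)
    rwa [Fintype.card_fin] at h
  have hle (a : Fin (2 ^ k)) : MulAction.period x a ≤ 2 ^ k := by
    rw [← card_filter_sameCycle x a]
    exact (Finset.card_le_univ _).trans_eq (Fintype.card_fin _)
  have hper (a : Fin (2 ^ k)) : ∃ i, MulAction.period x a = 2 ^ i := by
    obtain ⟨i, -, hi⟩ := (Nat.dvd_prime_pow Nat.prime_two).1
      (hm ▸ MulAction.period_dvd_orderOf x a)
    exact ⟨i, hi⟩
  constructor
  · contrapose!
    rintro ⟨hnc, hnf⟩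
    have hlt (a : Fin (2 ^ k)) : MulAction.period x a < 2 ^ k :=
      lt_of_le_of_ne (hle a) fun h => hnc (hcycle.2 ⟨a, h⟩)
    by_cases hfix : ∃ u, x u = u
    · obtain ⟨u, hu⟩ := hfix
      have hmk : m < k - 1 := by
        obtain ⟨y, hy⟩ := exists_period_eq_orderOf (α := Fin (2 ^ k)) hm
        have h1 := hlt y
        rw [hy, hm, Nat.pow_lt_pow_iff_right one_lt_two] at h1
        have h2 : m ≠ k - 1 := fun h => hnf (by rw [hm, h]) u hu
        omega
      refine subnormalizer_eq_top_of_fixed_point hcard hm hu fun y => ?_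
      obtain ⟨i, hi, hyi⟩ := (Nat.dvd_prime_pow Nat.prime_two).1
        (hm ▸ MulAction.period_dvd_orderOf x y)
      exact ⟨i, hi.trans_lt hmk, hyi⟩
    · push Not at hfix
      obtain ⟨a, -, b, -, hab, hne⟩ := exists_period_eq_not_sameCycle (x := x) (m := k)
        (S := Finset.univ) (fun y _ => by
          obtain ⟨i, hi⟩ := hper y
          exact ⟨i, (Nat.pow_lt_pow_iff_right one_lt_two).1 (hi ▸ hlt y), hi⟩) (by simp)
      exact subnormalizer_eq_top_of_no_fixed_point hcard hm hfix hab hne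
  · rintro (h | ⟨hord, u, hu⟩)
    · obtain ⟨a, ha⟩ := hcycle.1 h
      have hsame := forall_sameCycle_of_period_eq_card (ha.trans hcard.symm)
      refine subnormalizer_ne_top_of_sameCycle hlarge (fun b => ?_)
        fun b c => (hsame b).symm.trans (hsame c)
      rw [← (hsame b).period_eq, ha]
      exact dvd_pow_self 2 (by omega)
    · obtain ⟨y, hy⟩ := exists_period_eq_orderOf (α := Fin (2 ^ k)) hord
      exact subnormalizer_ne_top_of_fixed_point hlarge hu (by rw [hy, hord, hcard, h2k])

end
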